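/- A well behaved reduced Length Game profile (S_1,...,S_n) is in equilibrium if and only if: (1) all the valued cake is allocated, i.e. |(⋃_{i=1}^n P_i) \ (⋃_{i=1}^n S_i)| = 0; and (2) whenever |S_i ∩ P_j| > 0 for i ≠ j, |S_i| ≤ |S_j|. -/

import Mathlib

open MeasureTheory

/-- A piecewise uniform preference set: a finite union of closed intervals inside `[0,1]`
with positive total length. -/
def PWUniform (P : Set ℝ) : Prop :=
  (∃ (m : ℕ) (a b : Fin m → ℝ), P = ⋃ k, Set.Icc (a k) (b k)) ∧
    P ⊆ Set.Icc 0 1 ∧ 0 < volume P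

/-- Piecewise uniform utility: `u_P(X) = |X ∩ P| / |P|`. -/
noncomputable def pwUtil (P X : Set ℝ) : ℝ :=
  (volume (X ∩ P)).toReal / (volume P).toReal

/-- The Length Game precedence order: `i ≺ j` iff `|S i| < |S j|`, or `|S i| = |S j|`
and `i < j`. -/
def lgPrec {n : ℕ} (S : Fin n → Set ℝ) (i j : Fin n) : Prop :=
  volume (S i) < volume (S j) ∨ (volume (S i) = volume (S j) ∧ i < j)

/-- The Length Game allocation: `A i = S i \ ⋃_{j ≺ i} S j`. -/
def lgAlloc {n : ℕ} (S : Fin n → Set ℝ) (i : Fin n) : Set ℝ :=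
  S i \ ⋃ (j) (_ : lgPrec S j i), S j

/-- A valid Length Game strategy: a measurable subset of the cake `[0,1]`. -/
def IsStrategy (S : Set ℝ) : Prop :=
  MeasurableSet S ∧ S ⊆ Set.Icc 0 1

/-- A profile is in equilibrium if no agent can strictly increase their utility by
unilaterally switching to another strategy. -/
def lgEquilibrium {n : ℕ} (P S : Fin n → Set ℝ) : Prop :=
  ¬ ∃ (i : Fin n) (S' : Set ℝ), IsStrategy S' ∧
    pwUtil (P i) (lgAlloc S i) < pwUtil (P i) (lgAlloc (Function.update S i S') i)

theorem exists_subset_volume_pos_lt {s : Set ℝ} (hs : MeasurableSet s) (hpos : 0 < volume s)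
    {ε : ENNReal} (hε : 0 < ε) :
    ∃ t ⊆ s, MeasurableSet t ∧ 0 < volume t ∧ volume t < ε := by
  obtain ⟨x, -, hx⟩ := exists_mem_forall_mem_nhdsWithin_pos_measure hpos.ne'
  obtain ⟨δ, hδ, hδε⟩ := ENNReal.lt_iff_exists_nnreal_btwn.1 hε
  have hδ' : (0 : ℝ) < δ := by exact_mod_cast hδ
  refine ⟨s ∩ Metric.ball x (δ / 2), Set.inter_subset_left, hs.inter measurableSet_ball,
    hx _ (Filter.inter_mem self_mem_nhdsWithin
      (mem_nhdsWithin_of_mem_nhds (Metric.ball_mem_nhds x (by positivity)))), ?_⟩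
  refine (measure_mono Set.inter_subset_right).trans_lt ?_
  rw [Real.volume_ball, mul_div_cancel₀ _ two_ne_zero, ENNReal.ofReal_coe_nnreal]
  exact hδε

theorem volume_ne_top_of_subset_Icc {X : Set ℝ} (h : X ⊆ Set.Icc 0 1) : volume X ≠ ⊤ :=
  ((measure_mono h).trans_lt measure_Icc_lt_top).ne

theorem PWUniform.measurableSet {P : Set ℝ} (hP : PWUniform P) : MeasurableSet P := by
  obtain ⟨⟨m, a, b, rfl⟩, -⟩ := hP
  exact MeasurableSet.iUnion fun _ => measurableSet_Icc

theorem PWUniform.pwUtil_lt_iff {P : Set ℝ} (hP : PWUniform P) (X Y : Set ℝ) :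
    pwUtil P X < pwUtil P Y ↔ volume (X ∩ P) < volume (Y ∩ P) := by
  obtain ⟨-, hsub, hpos⟩ := hP
  have hfin (Z : Set ℝ) : volume (Z ∩ P) ≠ ⊤ :=
    volume_ne_top_of_subset_Icc (Set.inter_subset_right.trans hsub)
  rw [pwUtil, pwUtil, div_lt_div_iff_of_pos_right
    (ENNReal.toReal_pos hpos.ne' (volume_ne_top_of_subset_Icc hsub)),
    ENNReal.toReal_lt_toReal (hfin X) (hfin Y)]

theorem lgPrec_or_lgPrec_of_ne {n : ℕ} (S : Fin n → Set ℝ) {i j : Fin n} (h : i ≠ j) :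
    lgPrec S i j ∨ lgPrec S j i := by
  unfold lgPrec
  rcases lt_trichotomy (volume (S i)) (volume (S j)) with hv | hv | hv
  · exact Or.inl (Or.inl hv)
  · rcases h.lt_or_gt with hij | hij
    · exact Or.inl (Or.inr ⟨hv, hij⟩)
    · exact Or.inr (Or.inr ⟨hv.symm, hij⟩)
  · exact Or.inr (Or.inl hv)

theorem lgPrec.volume_le {n : ℕ} {S : Fin n → Set ℝ} {i j : Fin n} (h : lgPrec S i j) :
    volume (S i) ≤ volume (S j) :=
  h.elim le_of_lt fun h => h.1.le

theorem lgPrec.ne {n : ℕ} {S : Fin n → Set ℝ} {i j : Fin n} (h : lgPrec S i j) : i ≠ j := by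
  rintro rfl
  exact h.elim (lt_irrefl _) fun h => lt_irrefl _ h.2

theorem disjoint_of_reduced {n : ℕ} {S : Fin n → Set ℝ} (hreduced : ∀ i, S i = lgAlloc S i)
    {i j : Fin n} (hij : i ≠ j) : Disjoint (S i) (S j) := by
  have key {k l : Fin n} (h : lgPrec S k l) : Disjoint (S l) (S k) := by
    rw [hreduced l]
    exact Set.disjoint_sdiff_left.mono_right (Set.subset_iUnion₂_of_subset k h subset_rfl)
  exact (lgPrec_or_lgPrec_of_ne S hij).elim (fun h => (key h).symm) key

/-- A deviation to a longer valued set that avoids all strategies of at most its own length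
is profitable. -/
theorem not_lgEquilibrium_of_longer {n : ℕ} {P S : Fin n → Set ℝ} {i : Fin n} {S' : Set ℝ}
    (hP : PWUniform (P i)) (hS' : MeasurableSet S') (hsub : S' ⊆ P i)
    (hlt : volume (S i) < volume S')
    (hdisj : ∀ j, j ≠ i → volume (S j) ≤ volume S' → Disjoint S' (S j)) :
    ¬ lgEquilibrium P S := by
  refine not_not_intro ⟨i, S', ⟨hS', hsub.trans hP.2.1⟩, ?_⟩
  have halloc : lgAlloc (Function.update S i S') i = S' := by
    rw [lgAlloc, Function.update_self, sdiff_eq_left, Set.disjoint_iUnion₂_right]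
    intro j hj
    have hle := hj.volume_le
    rw [Function.update_self, Function.update_of_ne hj.ne] at hle
    rw [Function.update_of_ne hj.ne]
    exact hdisj j hj.ne hle
  rw [hP.pwUtil_lt_iff, halloc, Set.inter_eq_left.2 hsub]
  exact (measure_mono (Set.inter_subset_left.trans Set.sdiff_subset)).trans_lt hlt

/-- If all valued cake is allocated and every other strategy meeting `P i` in positive measure
is at most as long as `S i`, then no deviation secures agent `i` more valued cake than the
length of `S i`. -/
theorem volume_lgAlloc_update_inter_le {n : ℕ} {P S : Fin n → Set ℝ} {i : Fin n} (S' : Set ℝ)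
    (hcover : volume ((⋃ i, P i) \ ⋃ i, S i) = 0)
    (hshort : ∀ j, j ≠ i → 0 < volume (S j ∩ P i) → volume (S j) ≤ volume (S i)) :
    volume (lgAlloc (Function.update S i S') i ∩ P i) ≤ volume (S i) := by
  rcases le_or_gt (volume S') (volume (S i)) with hle | hlt
  · refine (measure_mono (Set.inter_subset_left.trans Set.sdiff_subset)).trans ?_
    rwa [Function.update_self]
  · apply measure_mono_ae
    have hnull : ∀ᵐ x, ∀ j, j ≠ i → volume (S j ∩ P i) = 0 → x ∉ S j ∩ P i := by
      rw [ae_all_iff]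
      intro j
      by_cases h : volume (S j ∩ P i) = 0
      · filter_upwards [measure_eq_zero_iff_ae_notMem.1 h] with x hx _ _ using hx
      · exact Filter.Eventually.of_forall fun _ _ h0 => absurd h0 h
    filter_upwards [hnull, measure_eq_zero_iff_ae_notMem.1 hcover] with x hx hxc hmem
    obtain ⟨⟨-, hxn⟩, hxP⟩ := hmem
    have hxS : x ∈ ⋃ j, S j := by
      by_contra h
      exact hxc ⟨Set.mem_iUnion.2 ⟨i, hxP⟩, h⟩
    obtain ⟨j, hj⟩ := Set.mem_iUnion.1 hxS
    rcases eq_or_ne j i with rfl | hji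
    · exact hj
    · have hpos : 0 < volume (S j ∩ P i) :=
        pos_iff_ne_zero.2 fun h0 => hx j hji h0 ⟨hj, hxP⟩
      refine absurd (Set.mem_iUnion₂.2 ⟨j, Or.inl ?_, ?_⟩) hxn
      · rw [Function.update_self, Function.update_of_ne hji]
        exact (hshort j hji hpos).trans_lt hlt
      · rwa [Function.update_of_ne hji]

/-- Characterisation of equilibria: a well behaved reduced Length Game profile is in
equilibrium if and only if (1) all the valued cake is allocated, and (2) whenever
`|S i ∩ P j| > 0` for `i ≠ j`, `|S i| ≤ |S j|`. -/
theorem length_game_equilibrium_iff {n : ℕ}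
    (P : Fin n → Set ℝ) (hP : ∀ i, PWUniform (P i))
    (S : Fin n → Set ℝ) (hS : ∀ i, IsStrategy (S i))
    (hreduced : ∀ i, S i = lgAlloc S i)
    (hwb : ∀ i, S i ⊆ P i) :
    lgEquilibrium P S ↔
      (volume ((⋃ i, P i) \ ⋃ i, S i) = 0 ∧
        ∀ i j, i ≠ j → 0 < volume (S i ∩ P j) → volume (S i) ≤ volume (S j)) := by
  have hdisj {i j : Fin n} (hij : i ≠ j) : Disjoint (S i) (S j) := disjoint_of_reduced hreduced hij
  have hlt_union {i : Fin n} {X : Set ℝ} (hX : MeasurableSet X) (hd : Disjoint (S i) X)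
      (hpos : 0 < volume X) : volume (S i) < volume (S i ∪ X) := by
    rw [measure_union hd hX]
    exact ENNReal.lt_add_right (volume_ne_top_of_subset_Icc (hS i).2) hpos.ne'
  constructor
  · refine fun heq => ⟨?_, ?_⟩
    · rw [Set.iUnion_sdiff, measure_iUnion_null_iff]
      intro i
      by_contra hne
      have hX : MeasurableSet (P i \ ⋃ j, S j) :=
        (hP i).measurableSet.diff (MeasurableSet.iUnion fun j => (hS j).1)
      have hd (j : Fin n) : Disjoint (P i \ ⋃ j, S j) (S j) :=
        Set.disjoint_sdiff_left.mono_right (Set.subset_iUnion S j)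
      exact not_lgEquilibrium_of_longer (hP i) ((hS i).1.union hX)
        (Set.union_subset (hwb i) Set.sdiff_subset)
        (hlt_union hX (hd i).symm (pos_iff_ne_zero.2 hne))
        (fun j hji _ => Set.disjoint_union_left.2 ⟨hdisj hji.symm, hd j⟩) heq
    · intro i j hij hpos
      by_contra! hlt
      obtain ⟨X, hXsub, hX, hXpos, hXlt⟩ := exists_subset_volume_pos_lt
        ((hS i).1.inter (hP j).measurableSet) hpos (tsub_pos_of_lt hlt)
      have hXS : X ⊆ S i := hXsub.trans Set.inter_subset_left
      have hshort : volume (S j ∪ X) < volume (S i) :=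
        (measure_union_le _ _).trans_lt (add_comm (volume X) _ ▸ lt_tsub_iff_right.1 hXlt)
      refine not_lgEquilibrium_of_longer (hP j) ((hS j).1.union hX)
        (Set.union_subset (hwb j) (hXsub.trans Set.inter_subset_right))
        (hlt_union hX ((hdisj hij.symm).mono_right hXS) hXpos) (fun k hkj hk => ?_) heq
      have hki : k ≠ i := by
        rintro rfl
        exact hk.not_gt hshort
      exact Set.disjoint_union_left.2 ⟨hdisj hkj.symm, (hdisj hki.symm).mono_left hXS⟩
  · rintro ⟨hcover, hshort⟩ ⟨i, S', -, hgain⟩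
    rw [(hP i).pwUtil_lt_iff, ← hreduced i, Set.inter_eq_left.2 (hwb i)] at hgain
    exact hgain.not_ge
      (volume_lgAlloc_update_inter_le S' hcover fun j hji => hshort j i hji)
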